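/- For every integer n ≥ 3 and every real c > 0, one has 2x₀·ω''(x₀) + ω'(x₀) > 0, and 2x·ω''(x) + ω'(x) tends to 1/(n−1)² (a positive number) as x → ∞. -/

import Mathlib

open Real Filter

noncomputable def alphaF (n : ℕ) (c : ℝ) (x : ℝ) : ℝ :=
  (n : ℝ) * c + ((n : ℝ) / (2 * ((n : ℝ) - 1))) * x
    - (((n : ℝ) - 2) / (2 * ((n : ℝ) - 1))) * Real.sqrt (x ^ 2 + 4 * ((n : ℝ) - 1) * c * x)

noncomputable def yn (n : ℕ) : ℝ :=
  4 * (1 - (n : ℝ)) + (2 * ((n : ℝ) ^ 2 - 4) / Real.sqrt (2 * (n : ℝ) - 5)) *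
    Real.cos ((1 / 3) * Real.arctan (((n : ℝ) ^ 2 - 4 * (n : ℝ) + 6) /
      (2 * ((n : ℝ) - 1) * Real.sqrt (2 * (n : ℝ) - 5))))

noncomputable def x0 (n : ℕ) (c : ℝ) : ℝ := yn n * c

noncomputable def betaF (n : ℕ) (c : ℝ) (x : ℝ) : ℝ :=
  alphaF n c (x0 n c) + deriv (alphaF n c) (x0 n c) * (x - x0 n c)
    + (1 / 2) * deriv (deriv (alphaF n c)) (x0 n c) * (x - x0 n c) ^ 2

noncomputable def gammaF (n : ℕ) (c : ℝ) (x : ℝ) : ℝ :=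
  if x0 n c ≤ x then alphaF n c x else betaF n c x

noncomputable def gammaF' (n : ℕ) (c : ℝ) (x : ℝ) : ℝ :=
  derivWithin (gammaF n c) (Set.Ici 0) x

noncomputable def gammaF'' (n : ℕ) (c : ℝ) (x : ℝ) : ℝ :=
  derivWithin (gammaF' n c) (Set.Ici 0) x

noncomputable def omegaF (n : ℕ) (c : ℝ) (x : ℝ) : ℝ :=
  (x ^ 2 / Real.sqrt (x ^ 2 + 4 * ((n : ℝ) - 1) * c * x)) *
    ((1 + (n : ℝ) ^ 2 * c / x) *
      (((n : ℝ) / ((n : ℝ) - 2) - (1 + 4 * ((n : ℝ) - 1) * c / x) ^ (-(1 / 2) : ℝ)) /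
       ((n : ℝ) / ((n : ℝ) - 2) + (1 + 4 * ((n : ℝ) - 1) * c / x) ^ (-(1 / 2) : ℝ)))) ^ 2

/-- The variable `t = √(1 + 4(n-1)c/x)`, in which `ω` is a rational function. -/
noncomputable def omegaParam (n : ℕ) (c x : ℝ) : ℝ := √(1 + 4 * ((n : ℝ) - 1) * c / x)

section

variable {n : ℕ} {c x : ℝ}

lemma omegaParam_radicand_gt_one (hn : 3 ≤ n) (hc : 0 < c) (hx : 0 < x) :
    1 < 1 + 4 * ((n : ℝ) - 1) * c / x := by
  have hn' : (3 : ℝ) ≤ n := by exact_mod_cast hn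
  have : 0 < 4 * ((n : ℝ) - 1) * c / x := by
    have : 0 < (n : ℝ) - 1 := by linarith
    positivity
  linarith

lemma one_lt_omegaParam (hn : 3 ≤ n) (hc : 0 < c) (hx : 0 < x) : 1 < omegaParam n c x := by
  rw [omegaParam, Real.lt_sqrt zero_le_one, one_pow]
  exact omegaParam_radicand_gt_one hn hc hx

lemma omegaParam_sq (hn : 3 ≤ n) (hc : 0 < c) (hx : 0 < x) :
    omegaParam n c x ^ 2 = 1 + 4 * ((n : ℝ) - 1) * c / x :=
  Real.sq_sqrt (by linarith [omegaParam_radicand_gt_one hn hc hx])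

lemma eq_div_omegaParam_sq_sub_one (hn : 3 ≤ n) (hc : 0 < c) (hx : 0 < x) :
    x = 4 * ((n : ℝ) - 1) * c / (omegaParam n c x ^ 2 - 1) := by
  have hn' : (3 : ℝ) ≤ n := by exact_mod_cast hn
  have : (n : ℝ) - 1 ≠ 0 := by linarith
  rw [omegaParam_sq hn hc hx]
  field_simp
  simp

lemma hasDerivAt_omegaParam (hn : 3 ≤ n) (hc : 0 < c) (hx : 0 < x) :
    HasDerivAt (omegaParam n c)
      (-(omegaParam n c x ^ 2 - 1) ^ 2 / (8 * ((n : ℝ) - 1) * c * omegaParam n c x)) x := by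
  have hn' : (3 : ℝ) ≤ n := by exact_mod_cast hn
  have h0 : (n : ℝ) - 1 ≠ 0 := by linarith
  have h1 := one_lt_omegaParam hn hc hx
  have hR := omegaParam_radicand_gt_one hn hc hx
  have h := (((hasDerivAt_const x (4 * ((n : ℝ) - 1) * c)).div (hasDerivAt_id x)
    hx.ne').const_add 1).sqrt (by simp only [Pi.div_apply, id]; linarith)
  refine h.congr_deriv ?_
  rw [omegaParam_sq hn hc hx]
  simp only [Pi.div_apply, id]
  rw [← omegaParam]
  have : omegaParam n c x ≠ 0 := by linarith
  field_simp
  ring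

lemma omegaF_eq_omegaParam (hn : 3 ≤ n) (hc : 0 < c) (hx : 0 < x) :
    omegaF n c x = c * (n * omegaParam n c x - (n - 2)) ^ 4 /
      (4 * ((n : ℝ) - 1) * (omegaParam n c x * (omegaParam n c x ^ 2 - 1))) := by
  have hn' : (3 : ℝ) ≤ n := by exact_mod_cast hn
  have hR := omegaParam_radicand_gt_one hn hc hx
  have hsqrt : √(x ^ 2 + 4 * ((n : ℝ) - 1) * c * x) = x * omegaParam n c x := by
    rw [omegaParam, show x ^ 2 + 4 * ((n : ℝ) - 1) * c * x
      = x ^ 2 * (1 + 4 * ((n : ℝ) - 1) * c / x) by field_simp,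
      Real.sqrt_mul (sq_nonneg x), Real.sqrt_sq hx.le]
  have hrpow : (1 + 4 * ((n : ℝ) - 1) * c / x) ^ (-(1 / 2) : ℝ) = (omegaParam n c x)⁻¹ := by
    rw [Real.rpow_neg (by linarith), ← Real.sqrt_eq_rpow, omegaParam]
  rw [omegaF, hsqrt, hrpow]
  have h1 := one_lt_omegaParam hn hc hx
  have hx' := eq_div_omegaParam_sq_sub_one hn hc hx
  generalize omegaParam n c x = t at *
  have ht : t ≠ 0 := by linarith
  have ht2 : t ^ 2 - 1 ≠ 0 := by nlinarith
  have h2 : (n : ℝ) - 2 ≠ 0 := by linarith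
  have h3 : (n : ℝ) - 1 ≠ 0 := by linarith
  have h4 : (n : ℝ) * t + (n - 2) ≠ 0 := by nlinarith
  have hfrac : ((n : ℝ) / (n - 2) - t⁻¹) / (n / (n - 2) + t⁻¹)
      = (n * t - (n - 2)) / (n * t + (n - 2)) := by
    have h5 : (n : ℝ) / (n - 2) + t⁻¹ ≠ 0 := by
      have : (n : ℝ) / (n - 2) + t⁻¹ = (n * t + (n - 2)) / ((n - 2) * t) := by field_simp
      rw [this]; positivity
    rw [div_eq_div_iff h5 h4]
    field_simp
  have hsum : 1 + (n : ℝ) ^ 2 * c / x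
      = (n * t - (n - 2)) * (n * t + (n - 2)) / (4 * (n - 1)) := by
    rw [hx']
    field_simp
    ring
  rw [hfrac, hsum, show x ^ 2 / (x * t) = x / t by field_simp, hx']
  field_simp

lemma hasDerivAt_omegaF (hn : 3 ≤ n) (hc : 0 < c) (hx : 0 < x) :
    HasDerivAt (omegaF n c)
      ((n * omegaParam n c x - (n - 2)) ^ 3 * (-n * omegaParam n c x ^ 3
        - 3 * (n - 2) * omegaParam n c x ^ 2 + 3 * n * omegaParam n c x + (n - 2)) /
        (32 * ((n : ℝ) - 1) ^ 2 * omegaParam n c x ^ 3)) x := by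
  have hn' : (3 : ℝ) ≤ n := by exact_mod_cast hn
  have h1 := one_lt_omegaParam hn hc hx
  have hT := hasDerivAt_omegaParam hn hc hx
  have h3 : (n : ℝ) - 1 ≠ 0 := by linarith
  have ht : omegaParam n c x ≠ 0 := by linarith
  have ht2 : omegaParam n c x ^ 2 - 1 ≠ 0 := by nlinarith
  have hd := ((((hT.const_mul (n : ℝ)).sub_const ((n : ℝ) - 2)).fun_pow 4).const_mul c).fun_div
    ((hT.fun_mul ((hT.fun_pow 2).sub_const 1)).const_mul (4 * ((n : ℝ) - 1)))
    (mul_ne_zero (mul_ne_zero four_ne_zero h3) (mul_ne_zero ht ht2))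
  refine (hd.congr_of_eventuallyEq ?_).congr_deriv ?_
  · filter_upwards [lt_mem_nhds hx] with z hz using omegaF_eq_omegaParam hn hc hz
  · generalize omegaParam n c x = t at *
    field_simp
    push_cast
    ring

lemma two_mul_deriv_deriv_omegaF_add_deriv (hn : 3 ≤ n) (hc : 0 < c) (hx : 0 < x) :
    2 * x * deriv (deriv (omegaF n c)) x + deriv (omegaF n c) x =
      (n * omegaParam n c x - (n - 2)) ^ 2 *
      (2 * n ^ 2 * omegaParam n c x ^ 6 + 4 * n * (n - 2) * omegaParam n c x ^ 5
        + (6 * (n - 2) ^ 2 - 3 * n ^ 2) * omegaParam n c x ^ 4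
        - 14 * n * (n - 2) * omegaParam n c x ^ 3
        + (3 * n ^ 2 - 7 * (n - 2) ^ 2) * omegaParam n c x ^ 2
        + 6 * n * (n - 2) * omegaParam n c x + 3 * (n - 2) ^ 2) /
      (32 * ((n : ℝ) - 1) ^ 2 * omegaParam n c x ^ 5) := by
  have hn' : (3 : ℝ) ≤ n := by exact_mod_cast hn
  have h1 := one_lt_omegaParam hn hc hx
  have hT := hasDerivAt_omegaParam hn hc hx
  have h3 : (n : ℝ) - 1 ≠ 0 := by linarith
  have ht : omegaParam n c x ≠ 0 := by linarith
  have ht2 : omegaParam n c x ^ 2 - 1 ≠ 0 := by nlinarith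
  have hd := ((((hT.const_mul (n : ℝ)).sub_const ((n : ℝ) - 2)).fun_pow 3).fun_mul
    (((((hT.fun_pow 3).const_mul (-(n : ℝ))).fun_sub
      ((hT.fun_pow 2).const_mul (3 * ((n : ℝ) - 2)))).fun_add
      (hT.const_mul (3 * (n : ℝ)))).add_const ((n : ℝ) - 2))).fun_div
    ((hT.fun_pow 3).const_mul (32 * ((n : ℝ) - 1) ^ 2))
    (mul_ne_zero (mul_ne_zero (by norm_num) (pow_ne_zero 2 h3)) (pow_ne_zero 3 ht))
  have hd' := hd.congr_of_eventuallyEq (f₁ := deriv (omegaF n c)) (by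
    filter_upwards [lt_mem_nhds hx] with z hz using (hasDerivAt_omegaF hn hc hz).deriv)
  rw [hd'.deriv, (hasDerivAt_omegaF hn hc hx).deriv]
  have hx' := eq_div_omegaParam_sq_sub_one hn hc hx
  generalize omegaParam n c x = t at *
  subst hx'
  field_simp
  push_cast
  ring

end

lemma omega_numerator_pos {a t : ℝ} (ha : 2 ≤ a) (ht : 1 < t) :
    0 < 2 * a ^ 2 * t ^ 6 + 4 * a * (a - 2) * t ^ 5
        + (6 * (a - 2) ^ 2 - 3 * a ^ 2) * t ^ 4 - 14 * a * (a - 2) * t ^ 3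
        + (3 * a ^ 2 - 7 * (a - 2) ^ 2) * t ^ 2 + 6 * a * (a - 2) * t + 3 * (a - 2) ^ 2 := by
  obtain ⟨u, rfl⟩ : ∃ u, t = 1 + u := ⟨t - 1, by ring⟩
  obtain ⟨b, rfl⟩ : ∃ b, a = b + 2 := ⟨a - 2, by ring⟩
  have hu : 0 < u := by linarith
  have hb : 0 ≤ b := by linarith
  set t := 1 + u with ht'
  have hA : 42 * u ^ 2 ≤ 2 * t ^ 6 + 4 * t ^ 5 + 3 * t ^ 4 - 14 * t ^ 3 - 4 * t ^ 2 + 6 * t + 3 := by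
    rw [← sub_nonneg, ht']; ring_nf; positivity
  have hB : -8 * u ≤ 8 * t ^ 6 + 8 * t ^ 5 - 12 * t ^ 4 - 28 * t ^ 3 + 12 * t ^ 2 + 12 * t := by
    rw [← sub_nonneg, ht']; ring_nf; positivity
  have hC : 8 ≤ 8 * t ^ 6 - 12 * t ^ 4 + 12 * t ^ 2 := by
    rw [← sub_nonneg, ht']; ring_nf; positivity
  have hA' := mul_le_mul_of_nonneg_left hA (sq_nonneg b)
  have hB' := mul_le_mul_of_nonneg_left hB hb
  nlinarith [sq_nonneg (b * u), sq_nonneg (b * u - 1)]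

lemma yn_pos {n : ℕ} (hn : 3 ≤ n) : 0 < yn n := by
  have hn' : (3 : ℝ) ≤ n := by exact_mod_cast hn
  rw [yn]
  set θ := Real.arctan (((n : ℝ) ^ 2 - 4 * n + 6) / (2 * (n - 1) * √(2 * n - 5)))
  have hcos : √3 / 2 < Real.cos (1 / 3 * θ) := by
    rw [← Real.cos_pi_div_six, ← Real.cos_abs (1 / 3 * θ)]
    have h1 : θ < π / 2 := Real.arctan_lt_pi_div_two _
    have h2 : -(π / 2) < θ := Real.neg_pi_div_two_lt_arctan _
    refine Real.cos_lt_cos_of_nonneg_of_le_pi_div_two (abs_nonneg _) (by linarith [Real.pi_pos]) ?_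
    rw [abs_lt]
    constructor <;> linarith
  have hr : 0 < 2 * (n : ℝ) - 5 := by linarith
  have hs : 0 < √(2 * (n : ℝ) - 5) := Real.sqrt_pos.2 hr
  have h4 : 0 < (n : ℝ) ^ 2 - 4 := by nlinarith
  have hle : 4 * ((n : ℝ) - 1) * √(2 * n - 5) ≤ (n ^ 2 - 4) * √3 := by
    refine le_of_sq_le_sq ?_ (by positivity)
    rw [mul_pow, mul_pow, mul_pow _ √3, Real.sq_sqrt hr.le, Real.sq_sqrt zero_le_three]
    nlinarith [mul_nonneg (sq_nonneg ((n : ℝ) - 4)) (show 0 ≤ 3 * (n : ℝ) ^ 2 - 8 * n + 8 by nlinarith)]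
  have hlt : 4 * ((n : ℝ) - 1) < 2 * (n ^ 2 - 4) / √(2 * n - 5) * Real.cos (1 / 3 * θ) := by
    rw [div_mul_eq_mul_div, lt_div_iff₀ hs]
    nlinarith
  linarith

lemma tendsto_omegaParam_atTop (n : ℕ) (c : ℝ) : Tendsto (omegaParam n c) atTop (nhds 1) := by
  have h := ((tendsto_const_nhds (x := 4 * ((n : ℝ) - 1) * c)).div_atTop tendsto_id).const_add 1
  rw [add_zero] at h
  simpa using! h.sqrt

theorem stmt_14 (n : ℕ) (hn : 3 ≤ n) (c : ℝ) (hc : 0 < c) :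
    2 * x0 n c * deriv (deriv (omegaF n c)) (x0 n c) + deriv (omegaF n c) (x0 n c) > 0 ∧
    Filter.Tendsto (fun x => 2 * x * deriv (deriv (omegaF n c)) x + deriv (omegaF n c) x)
      Filter.atTop (nhds (1 / ((n : ℝ) - 1) ^ 2)) ∧
    (0 : ℝ) < 1 / ((n : ℝ) - 1) ^ 2 := by
  have hn' : (3 : ℝ) ≤ n := by exact_mod_cast hn
  have h0 : 0 < (n : ℝ) - 1 := by linarith
  refine ⟨?_, ?_, by positivity⟩
  · have hx : 0 < x0 n c := mul_pos (yn_pos hn) hc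
    have ht := one_lt_omegaParam hn hc hx
    rw [two_mul_deriv_deriv_omegaF_add_deriv hn hc hx]
    have hQ := omega_numerator_pos (by linarith : (2 : ℝ) ≤ n) ht
    have h1 : 0 < (n : ℝ) * omegaParam n c (x0 n c) - (n - 2) := by nlinarith
    have h2 : 0 < omegaParam n c (x0 n c) := by linarith
    exact div_pos (mul_pos (pow_pos h1 2) hQ) (by positivity)
  · have hcont : ContinuousAt (fun t : ℝ => (n * t - (n - 2)) ^ 2 *
        (2 * n ^ 2 * t ^ 6 + 4 * n * (n - 2) * t ^ 5 + (6 * (n - 2) ^ 2 - 3 * n ^ 2) * t ^ 4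
        - 14 * n * (n - 2) * t ^ 3 + (3 * n ^ 2 - 7 * (n - 2) ^ 2) * t ^ 2
        + 6 * n * (n - 2) * t + 3 * (n - 2) ^ 2) / (32 * ((n : ℝ) - 1) ^ 2 * t ^ 5)) 1 := by
      refine ContinuousAt.div (by fun_prop) (by fun_prop) (by positivity)
    have h := hcont.tendsto.comp (tendsto_omegaParam_atTop n c)
    have hval : 1 / ((n : ℝ) - 1) ^ 2 = (n * 1 - (n - 2)) ^ 2 *
        (2 * n ^ 2 * 1 ^ 6 + 4 * n * (n - 2) * 1 ^ 5 + (6 * (n - 2) ^ 2 - 3 * n ^ 2) * 1 ^ 4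
        - 14 * n * (n - 2) * 1 ^ 3 + (3 * n ^ 2 - 7 * (n - 2) ^ 2) * 1 ^ 2
        + 6 * n * (n - 2) * 1 + 3 * (n - 2) ^ 2) / (32 * ((n : ℝ) - 1) ^ 2 * 1 ^ 5) := by
      field_simp
      ring
    rw [hval]
    refine h.congr' ?_
    filter_upwards [eventually_gt_atTop 0] with x hx
    exact (two_mul_deriv_deriv_omegaF_add_deriv hn hc hx).symm
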